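/- Let M be a Lie subalgebra of L of codimension one. Then i(M) = i(L) + 1 if and only if F(L) ⊆ M. -/

import Mathlib

open Module

noncomputable section

variable (k : Type*) [Field k]

/-- `L(f) = {x ∈ L | f ⁅x, y⁆ = 0 for all y ∈ L}`. -/
def lieStab (L : Type*) [LieRing L] [LieAlgebra k L] (f : Module.Dual k L) :
    Submodule k L where
  carrier := {x | ∀ y : L, f ⁅x, y⁆ = 0}
  add_mem' := fun {a b} ha hb y => by rw [add_lie, map_add, ha y, hb y, add_zero]
  zero_mem' := fun y => by rw [zero_lie, map_zero]
  smul_mem' := fun c a ha y => by rw [smul_lie, map_smul, ha y, smul_zero]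

/-- The index `i(L)`, the minimum of `dim L(f)` over all `f ∈ L*`. -/
def lieIndex (L : Type*) [LieRing L] [LieAlgebra k L] : ℕ :=
  ⨅ f : Module.Dual k L, finrank k (lieStab k L f)

/-- `f ∈ L*` is regular if `dim L(f) = i(L)`. -/
def LieIsRegular (L : Type*) [LieRing L] [LieAlgebra k L] (f : Module.Dual k L) : Prop :=
  finrank k (lieStab k L f) = lieIndex k L

/-- A commutative polarization of `L`: an abelian Lie subalgebra `P` with
`2 dim P = dim L + i(L)`. -/
def IsCP (L : Type*) [LieRing L] [LieAlgebra k L] (P : LieSubalgebra k L) : Prop :=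
  IsLieAbelian ↥P ∧ 2 * finrank k ↥P = finrank k L + lieIndex k L

/-- A CP-ideal of `L`: a CP which is also a Lie ideal of `L`. -/
def IsCPIdeal (L : Type*) [LieRing L] [LieAlgebra k L] (P : LieSubalgebra k L) : Prop :=
  IsCP k L P ∧ ∀ x y : L, y ∈ P → ⁅x, y⁆ ∈ P

/-- `L` is square integrable if `i(L) = dim Z(L)`. -/
def SquareIntegrable (L : Type*) [LieRing L] [LieAlgebra k L] : Prop :=
  lieIndex k L = finrank k ↥(LieAlgebra.center k L)


/-- The Frobenius semiradical `F(L)`, the span of the union of the `L(f)` over regular `f`. -/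
def frobSemiradical (L : Type*) [LieRing L] [LieAlgebra k L] : Submodule k L :=
  ⨆ f ∈ {f : Module.Dual k L | LieIsRegular k L f}, lieStab k L f

theorem map_subtype_ker_restrict {k V : Type*} [Field k] [AddCommGroup V] [Module k V]
    {B : LinearMap.BilinForm k V} (hB : B.IsAlt) (W : Submodule k V) :
    (LinearMap.ker (B.restrict W)).map W.subtype = W ⊓ B.orthogonal W := by
  ext x
  simp only [Submodule.mem_map, LinearMap.mem_ker, Submodule.mem_inf,
    LinearMap.BilinForm.mem_orthogonal_iff]
  constructor
  · rintro ⟨y, hy, rfl⟩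
    exact ⟨y.2, fun n hn => hB.eq_iff.1 (LinearMap.congr_fun hy ⟨n, hn⟩)⟩
  · rintro ⟨hx, h⟩
    exact ⟨⟨x, hx⟩, LinearMap.ext fun n => hB.eq_iff.1 (h n n.2), rfl⟩

theorem finrank_ker_restrict {k V : Type*} [Field k] [AddCommGroup V] [Module k V]
    {B : LinearMap.BilinForm k V} (hB : B.IsAlt) (W : Submodule k V) :
    finrank k (LinearMap.ker (B.restrict W)) = finrank k ↥(W ⊓ B.orthogonal W) := by
  rw [← map_subtype_ker_restrict hB, Submodule.finrank_map_subtype_eq]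

theorem Submodule.sup_span_singleton_eq_top_of_finrank {k V : Type*} [Field k] [AddCommGroup V]
    [Module k V] [FiniteDimensional k V] {W : Submodule k V} (hW : finrank k W + 1 = finrank k V)
    {x : V} (hx : x ∉ W) : W ⊔ Submodule.span k {x} = ⊤ := by
  apply Submodule.eq_top_of_finrank_eq
  have hlt : W < W ⊔ Submodule.span k {x} :=
    left_lt_sup.2 fun h => hx (h (Submodule.mem_span_singleton_self x))
  have := Submodule.finrank_lt_finrank_of_lt hlt
  have := Submodule.finrank_le (W ⊔ Submodule.span k {x})
  lia

/-- If the radical of an alternating form lies in a hyperplane, then the radical of the restriction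
to that hyperplane is one dimension larger. -/
theorem finrank_ker_restrict_of_ker_le {k V : Type*} [Field k] [AddCommGroup V] [Module k V]
    [FiniteDimensional k V] {B : LinearMap.BilinForm k V} (hB : B.IsAlt) {W : Submodule k V}
    (hW : finrank k W + 1 = finrank k V) (h : LinearMap.ker B ≤ W) :
    finrank k (LinearMap.ker (B.restrict W)) = finrank k (LinearMap.ker B) + 1 := by
  have horth : B.orthogonal W ≤ W := by
    intro x hx
    by_contra hxW
    refine hxW (h ?_)
    rw [← LinearMap.BilinForm.orthogonal_top_eq_ker hB.isRefl,
      ← Submodule.sup_span_singleton_eq_top_of_finrank hW hxW,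
      LinearMap.BilinForm.mem_orthogonal_iff]
    intro n hn
    obtain ⟨w, hw, z, hz, rfl⟩ := Submodule.mem_sup.1 hn
    obtain ⟨c, rfl⟩ := Submodule.mem_span_singleton.1 hz
    simp [hx w hw, hB.self_eq_zero x]
  have hdim := LinearMap.BilinForm.finrank_add_finrank_orthogonal hB.isRefl W
  rw [LinearMap.BilinForm.orthogonal_top_eq_ker hB.isRefl, inf_eq_right.2 h] at hdim
  rw [finrank_ker_restrict hB, inf_eq_right.2 horth]
  lia

/-- If the radical of an alternating form does not lie in a hyperplane, then the radical of the
restriction to that hyperplane is one dimension smaller. -/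
theorem finrank_ker_restrict_of_not_ker_le {k V : Type*} [Field k] [AddCommGroup V] [Module k V]
    [FiniteDimensional k V] {B : LinearMap.BilinForm k V} (hB : B.IsAlt) {W : Submodule k V}
    (hW : finrank k W + 1 = finrank k V) (h : ¬ LinearMap.ker B ≤ W) :
    finrank k (LinearMap.ker (B.restrict W)) + 1 = finrank k (LinearMap.ker B) := by
  obtain ⟨x, hx, hxW⟩ := SetLike.not_le_iff_exists.1 h
  have hsup := Submodule.sup_span_singleton_eq_top_of_finrank hW hxW
  have hinf : W ⊓ B.orthogonal W = W ⊓ LinearMap.ker B := by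
    rw [← LinearMap.BilinForm.orthogonal_top_eq_ker hB.isRefl]
    refine le_antisymm (inf_le_inf_left _ fun y hy => ?_)
      (inf_le_inf_left _ (LinearMap.BilinForm.orthogonal_le le_top))
    rw [← hsup, LinearMap.BilinForm.mem_orthogonal_iff]
    intro n hn
    obtain ⟨w, hw, z, hz, rfl⟩ := Submodule.mem_sup.1 hn
    obtain ⟨c, rfl⟩ := Submodule.mem_span_singleton.1 hz
    simp [hy w hw, LinearMap.mem_ker.1 hx]
  have htop : W ⊔ LinearMap.ker B = ⊤ :=
    top_unique (hsup ▸ sup_le_sup_left ((Submodule.span_singleton_le_iff_mem x _).2 hx) W)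
  have hdim := Submodule.finrank_sup_add_finrank_inf_eq W (LinearMap.ker B)
  rw [htop, finrank_top] at hdim
  rw [finrank_ker_restrict hB, hinf]
  lia

/-- An alternating form has even rank. -/
theorem even_finrank_add_finrank_ker {k : Type*} [Field k] (n : ℕ) :
    ∀ {V : Type*} [AddCommGroup V] [Module k V] [FiniteDimensional k V]
      {B : LinearMap.BilinForm k V}, B.IsAlt → finrank k V = n →
      Even (n + finrank k (LinearMap.ker B)) := by
  induction n with
  | zero =>
    intro V _ _ _ B _ hV
    have := Submodule.finrank_le (LinearMap.ker B)
    simp [show finrank k (LinearMap.ker B) = 0 by lia]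
  | succ n ih =>
    intro V _ _ _ B hB hV
    have : Nontrivial V := Module.nontrivial_of_finrank_pos (R := k) (by lia)
    obtain ⟨φ, hφ⟩ := exists_ne (0 : Module.Dual k V)
    have hW := Module.Dual.finrank_ker_add_one_of_ne_zero hφ
    have hWn : finrank k (LinearMap.ker φ) = n := by lia
    have heven := ih (B := B.restrict (LinearMap.ker φ)) (fun x => hB x) hWn
    by_cases h : LinearMap.ker B ≤ LinearMap.ker φ
    · rw [finrank_ker_restrict_of_ker_le hB hW h] at heven
      grind
    · rw [← finrank_ker_restrict_of_not_ker_le hB hW h]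
      grind

/-- The alternating form `(x, y) ↦ f ⁅x, y⁆` attached to `f ∈ L*`. -/
def lieForm {k L : Type*} [Field k] [LieRing L] [LieAlgebra k L] (f : Module.Dual k L) :
    LinearMap.BilinForm k L :=
  (LieModule.toEnd k L L : L →ₗ[k] Module.End k L).compr₂ f

theorem lieForm_isAlt {k L : Type*} [Field k] [LieRing L] [LieAlgebra k L]
    (f : Module.Dual k L) : (lieForm f).IsAlt := fun x => by
  simp [lieForm]

theorem ker_lieForm {k L : Type*} [Field k] [LieRing L] [LieAlgebra k L]
    (f : Module.Dual k L) : LinearMap.ker (lieForm f) = lieStab k L f := by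
  ext x
  exact LinearMap.ext_iff

theorem lieForm_restrict {k L : Type*} [Field k] [LieRing L] [LieAlgebra k L]
    (M : LieSubalgebra k L) (f : Module.Dual k L) :
    (lieForm f).restrict M.toSubmodule = lieForm (L := M) (f ∘ₗ M.toSubmodule.subtype) :=
  rfl

theorem lieIndex_le {k L : Type*} [Field k] [LieRing L] [LieAlgebra k L]
    (f : Module.Dual k L) : lieIndex k L ≤ finrank k (lieStab k L f) :=
  ciInf_le (OrderBot.bddBelow _) f

theorem exists_lieIsRegular (k L : Type*) [Field k] [LieRing L] [LieAlgebra k L] :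
    ∃ f : Module.Dual k L, LieIsRegular k L f :=
  ciInf_mem fun f : Module.Dual k L => finrank k (lieStab k L f)

theorem even_finrank_add_finrank_lieStab {k L : Type*} [Field k] [LieRing L] [LieAlgebra k L]
    [FiniteDimensional k L] (f : Module.Dual k L) :
    Even (finrank k L + finrank k (lieStab k L f)) := by
  rw [← ker_lieForm]
  exact even_finrank_add_finrank_ker _ (lieForm_isAlt f) rfl

theorem finrank_lieStab_restrict_of_le {k L : Type*} [Field k] [LieRing L] [LieAlgebra k L]
    [FiniteDimensional k L] {M : LieSubalgebra k L} (hM : finrank k ↥M + 1 = finrank k L)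
    {f : Module.Dual k L} (h : lieStab k L f ≤ M.toSubmodule) :
    finrank k (lieStab k M (f ∘ₗ M.toSubmodule.subtype)) = finrank k (lieStab k L f) + 1 := by
  rw [← ker_lieForm, ← lieForm_restrict, ← ker_lieForm f]
  exact finrank_ker_restrict_of_ker_le (lieForm_isAlt f) hM (ker_lieForm f ▸ h)

theorem finrank_lieStab_restrict_of_not_le {k L : Type*} [Field k] [LieRing L] [LieAlgebra k L]
    [FiniteDimensional k L] {M : LieSubalgebra k L} (hM : finrank k ↥M + 1 = finrank k L)
    {f : Module.Dual k L} (h : ¬ lieStab k L f ≤ M.toSubmodule) :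
    finrank k (lieStab k M (f ∘ₗ M.toSubmodule.subtype)) + 1 = finrank k (lieStab k L f) := by
  rw [← ker_lieForm, ← lieForm_restrict, ← ker_lieForm f]
  exact finrank_ker_restrict_of_not_ker_le (lieForm_isAlt f) hM (ker_lieForm f ▸ h)

/-- **Proposition 1.6 (4).** Let `M` be a codimension-one Lie subalgebra of `L`.  Then
`i(M) = i(L) + 1` iff `F(L) ⊆ M`. -/
theorem index_succ_iff_frobSemiradical_le {k L : Type*} [Field k] [CharZero k] [LieRing L]
    [LieAlgebra k L] [FiniteDimensional k L] (M : LieSubalgebra k L)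
    (hM : finrank k ↥M + 1 = finrank k L) :
    lieIndex k ↥M = lieIndex k L + 1 ↔ frobSemiradical k L ≤ M.toSubmodule := by
  rw [frobSemiradical, iSup₂_le_iff]
  constructor
  · intro h f (hf : finrank k (lieStab k L f) = lieIndex k L)
    by_contra hle
    have := finrank_lieStab_restrict_of_not_le hM hle
    have := lieIndex_le (L := M) (f ∘ₗ M.toSubmodule.subtype)
    lia
  · intro h
    obtain ⟨f₀, hf₀⟩ := exists_lieIsRegular k L
    have hupper := lieIndex_le (L := M) (f₀ ∘ₗ M.toSubmodule.subtype)
    rw [finrank_lieStab_restrict_of_le hM (h f₀ hf₀)] at hupper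
    obtain ⟨g, hg⟩ := exists_lieIsRegular k M
    obtain ⟨f, rfl⟩ : ∃ f : Module.Dual k L, f ∘ₗ M.toSubmodule.subtype = g :=
      LinearMap.exists_extend (p := M.toSubmodule) g
    have heven₀ := even_finrank_add_finrank_lieStab f₀
    have heven := even_finrank_add_finrank_lieStab f
    have hmin := lieIndex_le f
    rw [LieIsRegular] at hf₀ hg
    by_cases hle : lieStab k L f ≤ M.toSubmodule
    · have hval : lieIndex k M = finrank k (lieStab k L f) + 1 :=
        hg.symm.trans (finrank_lieStab_restrict_of_le hM hle)
      lia
    · have hval : lieIndex k M + 1 = finrank k (lieStab k L f) :=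
        hg ▸ finrank_lieStab_restrict_of_not_le hM hle
      have hne : finrank k (lieStab k L f) ≠ lieIndex k L := fun hf => hle (h f hf)
      rw [Nat.even_iff] at heven₀ heven
      lia

end
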